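/- Let F be a finite-dimensional normed vector space over ℂ, let U ⊆ ℂⁿ be a connected open set, and let p : U → F be analytic. Fix m ∈ ℕ and suppose that for every t ∈ U one has W_{m+1}(t) = W_m(t), and that the dimension of W_m(t) is a constant d for all t ∈ U. Then there exists a single d-dimensional subspace W ⊆ F such that W_m(t) = W for all t ∈ U; in particular p(t) ∈ W for every t ∈ U, so the image of p is contained in a d-dimensional linear subspace of F. -/

import Mathlib

/-- The partial derivative of `f : ℂⁿ → F` in the `j`-th coordinate direction. -/
noncomputable def pd {n : ℕ} {F : Type*} [NormedAddCommGroup F] [NormedSpace ℂ F]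
    (j : Fin n) (f : (Fin n → ℂ) → F) : (Fin n → ℂ) → F :=
  fun t => fderiv ℂ f t (Pi.single j 1)

/-- The iterated partial derivative `∂^I f = ∂₁^{i₁} ⋯ ∂ₙ^{iₙ} f` for a multi-index
`I : Fin n → ℕ`. -/
noncomputable def pdI {n : ℕ} {F : Type*} [NormedAddCommGroup F] [NormedSpace ℂ F]
    (I : Fin n → ℕ) (f : (Fin n → ℂ) → F) : (Fin n → ℂ) → F :=
  (List.finRange n).foldr (fun j g => (pd j)^[I j] g) f

/-- The order-`m` osculating space `W_m(t)`: the ℂ-linear span of the iterated partial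
derivatives `∂^I p(t)` with `|I| ≤ m`. -/
noncomputable def oscSpace {n : ℕ} {F : Type*} [NormedAddCommGroup F] [NormedSpace ℂ F]
    (p : (Fin n → ℂ) → F) (m : ℕ) (t : Fin n → ℂ) : Submodule ℂ F :=
  Submodule.span ℂ {v : F | ∃ I : Fin n → ℕ, (∑ j, I j) ≤ m ∧ v = pdI I p t}


theorem pd_congr {n : ℕ} {F : Type*} [NormedAddCommGroup F] [NormedSpace ℂ F]
    {U : Set (Fin n → ℂ)} (hU : IsOpen U) (j : Fin n) {f g : (Fin n → ℂ) → F}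
    (h : Set.EqOn f g U) : Set.EqOn (pd j f) (pd j g) U := by
  intro t ht
  have : f =ᶠ[nhds t] g := Filter.eventuallyEq_of_mem (hU.mem_nhds ht) h
  simp [pd, this.fderiv_eq]

theorem pd_iter_congr {n : ℕ} {F : Type*} [NormedAddCommGroup F] [NormedSpace ℂ F]
    {U : Set (Fin n → ℂ)} (hU : IsOpen U) (j : Fin n) (k : ℕ) {f g : (Fin n → ℂ) → F}
    (h : Set.EqOn f g U) : Set.EqOn ((pd j)^[k] f) ((pd j)^[k] g) U := by
  induction k generalizing f g with
  | zero => simpa using h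
  | succ k ih => simpa using ih (pd_congr hU j h)

theorem pd_analytic {n : ℕ} {F : Type*} [NormedAddCommGroup F] [NormedSpace ℂ F]
    [CompleteSpace F] {U : Set (Fin n → ℂ)} (j : Fin n) {f : (Fin n → ℂ) → F}
    (h : AnalyticOnNhd ℂ f U) : AnalyticOnNhd ℂ (pd j f) U := by
  intro t ht
  exact ((ContinuousLinearMap.apply ℂ F (Pi.single j 1 : Fin n → ℂ)).analyticAt _).comp
    (h.fderiv t ht)

theorem pd_iter_analytic {n : ℕ} {F : Type*} [NormedAddCommGroup F] [NormedSpace ℂ F]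
    [CompleteSpace F] {U : Set (Fin n → ℂ)} (j : Fin n) (k : ℕ) {f : (Fin n → ℂ) → F}
    (h : AnalyticOnNhd ℂ f U) : AnalyticOnNhd ℂ ((pd j)^[k] f) U := by
  induction k generalizing f with
  | zero => simpa using h
  | succ k ih => simpa using ih (pd_analytic j h)

theorem pd_comm {n : ℕ} {F : Type*} [NormedAddCommGroup F] [NormedSpace ℂ F]
    [CompleteSpace F] {U : Set (Fin n → ℂ)} (i j : Fin n) {f : (Fin n → ℂ) → F}
    (h : AnalyticOnNhd ℂ f U) : Set.EqOn (pd i (pd j f)) (pd j (pd i f)) U := by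
  intro t ht
  have hd : DifferentiableAt ℂ (fderiv ℂ f) t := (h.fderiv t ht).differentiableAt
  have key : ∀ a b : Fin n, pd a (pd b f) t
      = fderiv ℂ (fderiv ℂ f) t (Pi.single a 1) (Pi.single b 1) := by
    intro a b
    have := (hd.hasFDerivAt.clm_apply
      (hasFDerivAt_const (Pi.single b 1 : Fin n → ℂ) t)).fderiv
    change fderiv ℂ (fun y => (fderiv ℂ f y) (Pi.single b 1)) t (Pi.single a 1) = _
    rw [this]
    simp
  rw [key, key]
  have := (h t ht).contDiffAt (n := ⊤) |>.isSymmSndFDerivAt (by simp)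
  exact this _ _

theorem pd_iter_comm {n : ℕ} {F : Type*} [NormedAddCommGroup F] [NormedSpace ℂ F]
    [CompleteSpace F] {U : Set (Fin n → ℂ)} (hU : IsOpen U) (i j : Fin n) (k : ℕ)
    {f : (Fin n → ℂ) → F}
    (h : AnalyticOnNhd ℂ f U) : Set.EqOn (pd i ((pd j)^[k] f)) ((pd j)^[k] (pd i f)) U := by
  induction k generalizing f with
  | zero => intro t _; rfl
  | succ k ih =>
    have h1 := ih (pd_analytic j h)
    have h2 := pd_iter_congr hU j k (pd_comm i j h)
    simpa using h1.trans h2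

theorem fold_analytic {n : ℕ} {F : Type*} [NormedAddCommGroup F] [NormedSpace ℂ F]
    [CompleteSpace F] {U : Set (Fin n → ℂ)} (I : Fin n → ℕ) (l : List (Fin n))
    {f : (Fin n → ℂ) → F} (h : AnalyticOnNhd ℂ f U) :
    AnalyticOnNhd ℂ (l.foldr (fun j g => (pd j)^[I j] g) f) U := by
  induction l with
  | nil => simpa using h
  | cons a l ih => exact pd_iter_analytic a _ ih

theorem fold_notMem {n : ℕ} {F : Type*} [NormedAddCommGroup F] [NormedSpace ℂ F]
    (I : Fin n → ℕ) (l : List (Fin n)) (i : Fin n) (hi : i ∉ l) (f : (Fin n → ℂ) → F) :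
    l.foldr (fun j g => (pd j)^[(I + Pi.single i 1 : Fin n → ℕ) j] g) f
      = l.foldr (fun j g => (pd j)^[I j] g) f := by
  induction l with
  | nil => rfl
  | cons a l ih =>
    simp only [List.mem_cons, not_or] at hi
    simp only [List.foldr_cons]
    rw [ih hi.2]
    simp [Pi.single_eq_of_ne (Ne.symm hi.1)]

theorem fold_pd {n : ℕ} {F : Type*} [NormedAddCommGroup F] [NormedSpace ℂ F]
    [CompleteSpace F] {U : Set (Fin n → ℂ)} (hU : IsOpen U) (I : Fin n → ℕ)
    (l : List (Fin n)) (hl : l.Nodup) (i : Fin n) (hi : i ∈ l)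
    {f : (Fin n → ℂ) → F} (h : AnalyticOnNhd ℂ f U) :
    Set.EqOn (pd i (l.foldr (fun j g => (pd j)^[I j] g) f))
      (l.foldr (fun j g => (pd j)^[(I + Pi.single i 1 : Fin n → ℕ) j] g) f) U := by
  induction l with
  | nil => simp at hi
  | cons a l ih =>
    rw [List.nodup_cons] at hl
    simp only [List.foldr_cons]
    by_cases hia : i = a
    · subst hia
      rw [fold_notMem I l i hl.1]
      simp only [Pi.add_apply, Pi.single_eq_same, Function.iterate_succ_apply']
      intro t _; rfl
    · have hil : i ∈ l := by simpa [hia] using hi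
      have h1 := pd_iter_comm hU i a (I a) (fold_analytic I l h)
      have h2 := pd_iter_congr hU a (I a) (ih hl.2 hil)
      have h3 : (I + Pi.single i 1 : Fin n → ℕ) a = I a := by
        simp [Pi.single_eq_of_ne (Ne.symm hia)]
      rw [h3]
      exact h1.trans h2

theorem fderiv_pdI_mem {n : ℕ} {F : Type*} [NormedAddCommGroup F] [NormedSpace ℂ F]
    [CompleteSpace F] {U : Set (Fin n → ℂ)} (hU : IsOpen U) (I : Fin n → ℕ) (m : ℕ)
    (hI : ∑ j, I j ≤ m) {p : (Fin n → ℂ) → F} (hp : AnalyticOnNhd ℂ p U)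
    {t : Fin n → ℂ} (ht : t ∈ U) (h : Fin n → ℂ) :
    fderiv ℂ (pdI I p) t h ∈ oscSpace p (m + 1) t := by
  have hh : h = ∑ j, h j • (Pi.single j 1 : Fin n → ℂ) := pi_eq_sum_univ' h
  rw [hh, map_sum]
  refine Submodule.sum_mem _ fun j _ => ?_
  rw [map_smul]
  refine Submodule.smul_mem _ _ (Submodule.subset_span ⟨I + Pi.single j 1, ?_, ?_⟩)
  · simp [Finset.sum_add_distrib, hI]
  · exact fold_pd hU I _ (List.nodup_finRange n) j (List.mem_finRange j) hp ht

theorem local_const {E F : Type*} [NormedAddCommGroup E] [NormedSpace ℂ E]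
    [NormedAddCommGroup F] [NormedSpace ℂ F] [FiniteDimensional ℂ F]
    (U : Set E) (hU : IsOpen U) (W : E → Submodule ℂ F) (d : ℕ)
    (hdim : ∀ t ∈ U, Module.finrank ℂ (W t) = d) (t₀ : E) (ht₀ : t₀ ∈ U)
    (hf : ∀ w ∈ W t₀, ∃ f : E → F, f t₀ = w ∧ DifferentiableOn ℂ f U ∧
      ∀ t ∈ U, f t ∈ W t ∧ ∀ h, fderiv ℂ f t h ∈ W t) :
    ∀ᶠ t in nhds t₀, W t = W t₀ := by
  classical
  let b := Module.finBasis ℂ (W t₀)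
  have hf' := fun k => hf (b k) (b k).2
  choose f hf0 hfd hfW using hf'
  obtain ⟨π0, hπ0⟩ := (W t₀).subtype.exists_leftInverse_of_injective (by simp)
  let π : F →L[ℂ] W t₀ := LinearMap.toContinuousLinearMap π0
  let φ : ∀ k, W t₀ →L[ℂ] ℂ := fun k => LinearMap.toContinuousLinearMap (b.coord k)
  let G : E → (W t₀ →L[ℂ] F) := fun t => ∑ k, (φ k).smulRight (f k t)
  have hGapp : ∀ t x, G t x = ∑ k, φ k x • f k t := by
    intro t x; simp [G]
  have hGd : ∀ t ∈ U, DifferentiableAt ℂ G t := by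
    intro t ht
    have : ∀ k, DifferentiableAt ℂ (f k) t := fun k =>
      (hfd k).differentiableAt (hU.mem_nhds ht)
    have h2 : G = fun t => ∑ k, ContinuousLinearMap.smulRightL ℂ (W t₀) F (φ k) (f k t) := by
      funext t; simp [G]
    rw [h2]
    fun_prop
  have hGmem : ∀ t ∈ U, ∀ x, G t x ∈ W t := by
    intro t ht x
    rw [hGapp]
    exact Submodule.sum_mem _ fun k _ => Submodule.smul_mem _ _ (hfW k t ht).1
  have hG0 : ∀ x, G t₀ x = x := by
    intro x
    rw [hGapp]
    simp only [hf0]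
    have := congrArg Subtype.val (b.sum_repr x)
    rw [Submodule.coe_sum] at this
    exact this
  have hπ : ∀ x : W t₀, π x = x := fun x => LinearMap.congr_fun hπ0 x
  let A : E → (W t₀ →L[ℂ] W t₀) := fun t => π.comp (G t)
  have hA0 : A t₀ = 1 := by
    ext1 x
    simp [A, hG0, hπ]
  have hAd : ∀ t ∈ U, DifferentiableAt ℂ A t := fun t ht => by
    have := hGd t ht
    simp only [A]
    fun_prop
  have hunit : ∀ᶠ t in nhds t₀, IsUnit (A t) := by
    have hc : ContinuousAt A t₀ := (hAd t₀ ht₀).continuousAt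
    have h1 : IsUnit (A t₀) := by rw [hA0]; exact isUnit_one
    exact hc.eventually_mem (Units.isOpen (R := W t₀ →L[ℂ] W t₀) |>.mem_nhds h1)
  obtain ⟨r, hr, hball⟩ := Metric.eventually_nhds_iff_ball.1 (hunit.and (hU.mem_nhds ht₀))
  let c : E → (W t₀ →L[ℂ] W t₀) := fun t => Ring.inverse (A t)
  have hinj : ∀ t ∈ Metric.ball t₀ r, ∀ y ∈ W t, π y = 0 → y = 0 := by
    intro t ht y hy hπy
    obtain ⟨hu, htU⟩ := hball t ht
    have hAinj : ∀ x, A t x = 0 → x = 0 := by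
      intro x hx
      have := congrArg (fun L : W t₀ →L[ℂ] W t₀ => L x) (Ring.inverse_mul_cancel _ hu)
      simpa [hx] using this.symm
    have hker : LinearMap.ker (G t : W t₀ →ₗ[ℂ] F) = ⊥ := by
      rw [LinearMap.ker_eq_bot']
      intro x hx
      apply hAinj
      have hx' : G t x = 0 := hx
      simp [A, hx']
    have hrange : LinearMap.range (G t : W t₀ →ₗ[ℂ] F) = W t := by
      apply Submodule.eq_of_le_of_finrank_eq
      · rintro _ ⟨x, rfl⟩
        exact hGmem t htU x
      · rw [LinearMap.finrank_range_of_inj (LinearMap.ker_eq_bot.1 hker), hdim t htU,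
          hdim t₀ ht₀]
    rw [← hrange] at hy
    obtain ⟨x, rfl⟩ := hy
    have : x = 0 := hAinj x hπy
    simp [this]
  have hcd : ∀ t ∈ Metric.ball t₀ r, DifferentiableAt ℂ c t := by
    intro t ht
    obtain ⟨hu, htU⟩ := hball t ht
    have h1 : DifferentiableAt ℂ (Ring.inverse : (W t₀ →L[ℂ] W t₀) → (W t₀ →L[ℂ] W t₀)) (A t) :=
      differentiableAt_inverse (𝕜 := ℂ) (R := W t₀ →L[ℂ] W t₀) hu
    exact DifferentiableAt.comp (𝕜 := ℂ) (G := W t₀ →L[ℂ] W t₀) (F := W t₀ →L[ℂ] W t₀)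
      t h1 (hAd t htU)
  have hle : ∀ t ∈ Metric.ball t₀ r, W t₀ ≤ W t := by
    intro t ht w hw
    let w' : W t₀ := ⟨w, hw⟩
    let g : E → F := fun t => G t (c t w')
    have hder : ∀ s ∈ Metric.ball t₀ r, HasFDerivAt g (0 : E →L[ℂ] F) s := by
      intro s hs
      obtain ⟨hu, hsU⟩ := hball s hs
      have hcs := hcd s hs
      have ha : ∀ k, DifferentiableAt ℂ (fun t => φ k (c t w')) s := fun k => by fun_prop
      have hfs : ∀ k, DifferentiableAt ℂ (f k) s := fun k =>
        (hfd k).differentiableAt (hU.mem_nhds hsU)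
      have hg : HasFDerivAt g (∑ k, (φ k (c s w') • fderiv ℂ (f k) s +
          (fderiv ℂ (fun t => φ k (c t w')) s).smulRight (f k s))) s := by
        have h2 : g = fun t => ∑ k, φ k (c t w') • f k t := by
          funext t; exact hGapp t _
        rw [h2]
        exact HasFDerivAt.fun_sum fun k _ => (ha k).hasFDerivAt.smul (hfs k).hasFDerivAt
      have hπg : HasFDerivAt (fun t => π (g t)) (0 : E →L[ℂ] W t₀) s := by
        have : (fun t => π (g t)) =ᶠ[nhds s] fun _ => w' := by
          filter_upwards [Metric.isOpen_ball.mem_nhds hs] with q hq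
          have := congrArg (fun L : W t₀ →L[ℂ] W t₀ => L w')
            (Ring.mul_inverse_cancel _ (hball q hq).1)
          simpa [A, g, c] using this
        exact (hasFDerivAt_const w' s).congr_of_eventuallyEq this
      have hπg' := π.hasFDerivAt.comp s hg
      have heq := hπg'.unique hπg
      convert hg using 1
      symm
      ext h
      apply hinj s hs
      · simp only [sum_apply, add_apply,
          smul_apply, ContinuousLinearMap.smulRight_apply]
        exact Submodule.sum_mem _ fun k _ => Submodule.add_mem _
          (Submodule.smul_mem _ _ ((hfW k s hsU).2 h)) (Submodule.smul_mem _ _ (hfW k s hsU).1)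
      · exact congrArg (fun L : E →L[ℂ] W t₀ => L h) heq
    have hconst : g t = g t₀ := by
      refine (Metric.isOpen_ball).is_const_of_fderiv_eq_zero (𝕜 := ℂ)
        (convex_ball t₀ r).isPreconnected
        (fun s hs => (hder s hs).differentiableAt.differentiableWithinAt)
        (fun s hs => (hder s hs).fderiv) ht (Metric.mem_ball_self hr)
    have hg0 : g t₀ = w := by
      simp [g, c, hA0, hG0, w']
    rw [← hg0, ← hconst]
    exact hGmem t (hball t ht).2 _
  filter_upwards [Metric.ball_mem_nhds t₀ hr] with t ht
  exact (Submodule.eq_of_le_of_finrank_eq (hle t ht)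
    (by rw [hdim t₀ ht₀, hdim t (hball t ht).2])).symm

/-- Local analytic form of the Chiantini–Ciliberto proposition: if `p : U → F` is analytic
on a connected open `U ⊆ ℂⁿ`, `W_{m+1}(t) = W_m(t)` for all `t ∈ U`, and `dim W_m(t) = d`
is constant on `U`, then there is a single `d`-dimensional subspace `W ⊆ F` with
`W_m(t) = W` for all `t ∈ U`; in particular `p(t) ∈ W` for every `t ∈ U`. -/
theorem oscSpace_constant_of_stable {n m d : ℕ} {F : Type*} [NormedAddCommGroup F]
    [NormedSpace ℂ F] [FiniteDimensional ℂ F]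
    (U : Set (Fin n → ℂ)) (hUopen : IsOpen U) (hUconn : IsConnected U)
    (p : (Fin n → ℂ) → F) (hp : AnalyticOnNhd ℂ p U)
    (hstable : ∀ t ∈ U, oscSpace p (m + 1) t = oscSpace p m t)
    (hdim : ∀ t ∈ U, Module.finrank ℂ (oscSpace p m t) = d) :
    ∃ W : Submodule ℂ F, Module.finrank ℂ W = d ∧
      (∀ t ∈ U, oscSpace p m t = W) ∧ ∀ t ∈ U, p t ∈ W := by
  have : CompleteSpace F := FiniteDimensional.complete ℂ F
  have hloc : ∀ t₀ ∈ U, ∀ᶠ t in nhds t₀, oscSpace p m t = oscSpace p m t₀ := by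
    intro t₀ ht₀
    refine local_const U hUopen (oscSpace p m) d hdim t₀ ht₀ ?_
    intro w hw
    induction hw using Submodule.span_induction with
    | mem v hv =>
      obtain ⟨I, hI, rfl⟩ := hv
      refine ⟨pdI I p, rfl, (fold_analytic I _ hp).differentiableOn, fun t ht => ⟨?_, fun h => ?_⟩⟩
      · exact Submodule.subset_span ⟨I, hI, rfl⟩
      · rw [← hstable t ht]
        exact fderiv_pdI_mem hUopen I m hI hp ht h
    | zero => exact ⟨fun _ => 0, rfl, by fun_prop, fun t ht => by simp⟩
    | add x y _ _ hx hy =>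
      obtain ⟨f, hf0, hfd, hfW⟩ := hx
      obtain ⟨g, hg0, hgd, hgW⟩ := hy
      refine ⟨fun t => f t + g t, by simp [hf0, hg0], hfd.add hgd, fun t ht => ⟨?_, fun h => ?_⟩⟩
      · exact Submodule.add_mem _ (hfW t ht).1 (hgW t ht).1
      · rw [fderiv_fun_add (hfd.differentiableAt (hUopen.mem_nhds ht))
          (hgd.differentiableAt (hUopen.mem_nhds ht))]
        exact Submodule.add_mem _ ((hfW t ht).2 h) ((hgW t ht).2 h)
    | smul a x _ hx =>
      obtain ⟨f, hf0, hfd, hfW⟩ := hx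
      refine ⟨fun t => a • f t, by simp [hf0], hfd.const_smul a, fun t ht => ⟨?_, fun h => ?_⟩⟩
      · exact Submodule.smul_mem _ _ (hfW t ht).1
      · rw [fderiv_fun_const_smul (hfd.differentiableAt (hUopen.mem_nhds ht))]
        exact Submodule.smul_mem _ _ ((hfW t ht).2 h)
  obtain ⟨t₀, ht₀⟩ := hUconn.nonempty
  have hall : ∀ t ∈ U, oscSpace p m t = oscSpace p m t₀ := by
    intro t ht
    refine hUconn.isPreconnected.induction₂ (fun x y => oscSpace p m x = oscSpace p m y)
      ?_ ?_ ?_ ht ht₀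
    · intro x hx
      filter_upwards [nhdsWithin_le_nhds (hloc x hx)] with y hy using hy.symm
    · intro x y z _ _ _ h1 h2
      exact h1.trans h2
    · intro x y _ _ h
      exact h.symm
  refine ⟨oscSpace p m t₀, hdim t₀ ht₀, hall, fun t ht => ?_⟩
  rw [← hall t ht]
  refine Submodule.subset_span ⟨0, by simp, ?_⟩
  have : ∀ l : List (Fin n),
      l.foldr (fun j g => (pd j)^[(0 : Fin n → ℕ) j] g) p = p := by
    intro l
    induction l with
    | nil => rfl
    | cons a l ih => simp
  rw [pdI, this]
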